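/- Let b = g(a) + ε with g an invertible bimeasurable map and ε independent of a with everywhere-nonvanishing characteristic function. Then the induced map from the distribution of a to the distribution of b is injective. -/

import Mathlib

open MeasureTheory

/-- Characteristic function of a measure on `ℝ`. -/
noncomputable def charFn (μ : Measure ℝ) (t : ℝ) : ℂ :=
  ∫ x, Complex.exp (t * x * Complex.I) ∂μ

theorem charFn_eq_charFun (μ : Measure ℝ) (t : ℝ) : charFn μ t = charFun μ t :=
  (charFun_apply_real t).symm

/-- Convolution with a finite measure whose characteristic function vanishes nowhere is injective
on finite measures. -/
theorem conv_right_cancel_of_charFun_ne_zero {μ₁ μ₂ ν : Measure ℝ} [IsFiniteMeasure μ₁]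
    [IsFiniteMeasure μ₂] [IsFiniteMeasure ν] (hν : ∀ t, charFun ν t ≠ 0)
    (h : μ₁.conv ν = μ₂.conv ν) : μ₁ = μ₂ := by
  refine Measure.ext_of_charFun (funext fun t => mul_right_cancel₀ (hν t) ?_)
  rw [← charFun_conv, ← charFun_conv, h]

/-- Nonlinear additive model `b = g(a) + ε`: if `g` is an invertible bimeasurable
map and `ε` is independent noise with everywhere-nonvanishing characteristic
function, then the induced map from the law of `a` to the law of `b`,
`μ ↦ (g_*μ) ∗ ν`, is injective on probability measures. -/
theorem nonlinear_additive_injective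
    (g : ℝ ≃ ℝ) (hg : Measurable g) (hg' : Measurable g.symm)
    (ν : Measure ℝ) [IsProbabilityMeasure ν] (hν : ∀ t, charFn ν t ≠ 0)
    (μ₁ μ₂ : Measure ℝ) [IsProbabilityMeasure μ₁] [IsProbabilityMeasure μ₂]
    (h : (Measure.map g μ₁).conv ν = (Measure.map g μ₂).conv ν) : μ₁ = μ₂ := by
  have hmap : Measure.map g μ₁ = Measure.map g μ₂ :=
    conv_right_cancel_of_charFun_ne_zero (fun t => charFn_eq_charFun ν t ▸ hν t) h
  let e : ℝ ≃ᵐ ℝ := ⟨g, hg, hg'⟩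
  exact e.map_measurableEquiv_injective hmap
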